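/- Let r > 1 and let k, ℓ, m be positive integers. The discrete-time Moran process with fitness r on the (k,ℓ,m)-superstar, started from a single initial mutant placed at a uniformly random vertex, has extinction probability at least k/(2r(m+k)). -/

import Mathlib

open Finset

/-- Total fitness of the mutant set `S` (mutants have fitness `r`, non-mutants fitness `1`). -/
noncomputable def moranW {V : Type*} [Fintype V] (r : ℝ) (S : Finset V) : ℝ :=
  r * S.card + ((Fintype.card V : ℝ) - S.card)

/-- One-step transition probability of the Moran process with fitness `r` and
reproduction weights `w`, from mutant set `S` to mutant set `T`:  a vertex `u` is chosen
with probability `r / moranW r S` if it is a mutant and `1 / moranW r S` otherwise, then a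
target `v` is chosen with probability `w u v`, and `v` becomes a mutant if `u` is one and
a non-mutant otherwise. -/
noncomputable def moranStep {V : Type*} [Fintype V] [DecidableEq V]
    (r : ℝ) (w : V → V → ℝ) (S T : Finset V) : ℝ :=
  ∑ u : V, ∑ v : V,
    ((if u ∈ S then r else 1) / moranW r S) * w u v *
      (if (if u ∈ S then insert v S else S.erase v) = T then 1 else 0)

/-- Distribution of the Moran process after `t` steps, from initial distribution `init`. -/
noncomputable def moranDist {V : Type*} [Fintype V] [DecidableEq V]
    (r : ℝ) (w : V → V → ℝ) (init : Finset V → ℝ) : ℕ → Finset V → ℝ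
  | 0 => init
  | t + 1 => fun T => ∑ S : Finset V, moranDist r w init t S * moranStep r w S T

/-- Reproduction weights of the (unweighted) Moran process on the digraph with
out-neighbourhoods `out`: the offspring goes to a uniformly random out-neighbour. -/
noncomputable def outWeights {V : Type*} [DecidableEq V]
    (out : V → Finset V) : V → V → ℝ :=
  fun u v => if v ∈ out u then ((out u).card : ℝ)⁻¹ else 0

/-- Extinction probability: `sup_t Pr(S_t = ∅)`. -/
noncomputable def extinctionProb {V : Type*} [Fintype V] [DecidableEq V]
    (r : ℝ) (w : V → V → ℝ) (init : Finset V → ℝ) : ℝ :=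
  ⨆ t : ℕ, moranDist r w init t (∅ : Finset V)

/-- Fixation probability: `sup_t Pr(S_t = V)`. -/
noncomputable def fixationProb {V : Type*} [Fintype V] [DecidableEq V]
    (r : ℝ) (w : V → V → ℝ) (init : Finset V → ℝ) : ℝ :=
  ⨆ t : ℕ, moranDist r w init t (Finset.univ : Finset V)

/-- Initial distribution: a single mutant at a uniformly random vertex. -/
noncomputable def uniformSingleton (V : Type*) [Fintype V] [DecidableEq V] :
    Finset V → ℝ :=
  fun S => if S.card = 1 then (Fintype.card V : ℝ)⁻¹ else 0

/-- Initial distribution: a single mutant at the fixed vertex `x₀`. -/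
def pointInit {V : Type*} [DecidableEq V] (x₀ : V) : Finset V → ℝ :=
  fun S => if S = {x₀} then 1 else 0

/-- Vertices of the `(k,ℓ,m)`-superstar: `ℓ` reservoirs `R_i` of size `m`
(`Sum.inl (i, x)`), path vertices `v_{i,j}` for `i ∈ [ℓ]`, `j ∈ [k]`
(`Sum.inr (Sum.inl (i, j))`), and the centre vertex `v*` (`Sum.inr (Sum.inr ())`).
It has `ℓ * (k + m) + 1` vertices. -/
abbrev SuperstarV (k ℓ m : ℕ) : Type :=
  (Fin ℓ × Fin m) ⊕ ((Fin ℓ × Fin k) ⊕ Unit)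

/-- Out-neighbourhoods of the `(k,ℓ,m)`-superstar: the centre points to every reservoir
vertex, each vertex of `R_i` points to `v_{i,1}`, each `v_{i,j}` points to `v_{i,j+1}`
for `j < k`, and `v_{i,k}` points to the centre. -/
def superstarOut (k ℓ m : ℕ) : SuperstarV k ℓ m → Finset (SuperstarV k ℓ m)
  | Sum.inl (i, _) =>
      if h : 0 < k then {Sum.inr (Sum.inl (i, ⟨0, h⟩))} else {Sum.inr (Sum.inr ())}
  | Sum.inr (Sum.inl (i, j)) =>
      if h : (j : ℕ) + 1 < k then {Sum.inr (Sum.inl (i, ⟨(j : ℕ) + 1, h⟩))}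
      else {Sum.inr (Sum.inr ())}
  | Sum.inr (Sum.inr _) =>
      (Finset.univ : Finset (Fin ℓ × Fin m)).image fun p => Sum.inl p

section Helpers

variable {V : Type*} [Fintype V] [DecidableEq V]

lemma step_expect (r : ℝ) (w : V → V → ℝ) (S : Finset V) (f : Finset V → ℝ) :
    ∑ T, moranStep r w S T * f T = ∑ u : V, ∑ v : V,
      ((if u ∈ S then r else 1) / moranW r S) * w u v *
        f (if u ∈ S then insert v S else S.erase v) := by
  unfold moranStep
  simp_rw [Finset.sum_mul]
  rw [Finset.sum_comm]
  refine Finset.sum_congr rfl fun u _ => ?_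
  rw [Finset.sum_comm]
  refine Finset.sum_congr rfl fun v _ => ?_
  rw [Finset.sum_eq_single (if u ∈ S then insert v S else S.erase v)]
  · simp
  · intro b _ hb
    rw [if_neg (Ne.symm hb)]
    simp
  · simp

lemma moranW_eq (r : ℝ) (S : Finset V) :
    moranW r S = ∑ u : V, (if u ∈ S then r else 1) := by
  have : ∀ u : V, (if u ∈ S then r else (1:ℝ)) = 1 + (if u ∈ S then r - 1 else 0) := by
    intro u; split_ifs <;> ring
  simp_rw [this, Finset.sum_add_distrib]
  simp [moranW]
  ring

lemma moranW_pos [Nonempty V] {r : ℝ} (hr : 1 < r) (S : Finset V) : 0 < moranW r S := by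
  rw [moranW_eq]
  refine Finset.sum_pos (fun u _ => ?_) Finset.univ_nonempty
  split_ifs <;> linarith

lemma step_sum [Nonempty V] {r : ℝ} (hr : 1 < r) (w : V → V → ℝ)
    (hw1 : ∀ u, ∑ v, w u v = 1) (S : Finset V) : ∑ T, moranStep r w S T = 1 := by
  have h := step_expect r w S (fun _ => 1)
  simp only [mul_one] at h
  rw [h]
  simp_rw [← Finset.mul_sum, hw1, mul_one, ← Finset.sum_div]
  rw [← moranW_eq]
  exact div_self (moranW_pos hr S).ne'

lemma step_nonneg [Nonempty V] {r : ℝ} (hr : 1 < r) (w : V → V → ℝ)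
    (hw : ∀ u v, 0 ≤ w u v) (S T : Finset V) : 0 ≤ moranStep r w S T := by
  have hW := moranW_pos hr S
  unfold moranStep
  refine Finset.sum_nonneg fun u _ => Finset.sum_nonneg fun v _ => ?_
  have h1 : (0:ℝ) ≤ if u ∈ S then r else 1 := by split_ifs <;> linarith
  have := hw u v
  refine mul_nonneg (mul_nonneg (div_nonneg h1 hW.le) this) ?_
  split_ifs <;> norm_num

lemma dist_nonneg' [Nonempty V] {r : ℝ} (hr : 1 < r) (w : V → V → ℝ)
    (hw : ∀ u v, 0 ≤ w u v) (init : Finset V → ℝ) (hi : ∀ S, 0 ≤ init S) (t : ℕ)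
    (S : Finset V) : 0 ≤ moranDist r w init t S := by
  induction t generalizing S with
  | zero => exact hi S
  | succ t ih =>
    exact Finset.sum_nonneg fun T _ => mul_nonneg (ih T) (step_nonneg hr w hw T S)

lemma dist_expect (r : ℝ) (w : V → V → ℝ) (init : Finset V → ℝ) (t : ℕ) (f : Finset V → ℝ) :
    ∑ T, moranDist r w init (t+1) T * f T =
      ∑ S, moranDist r w init t S * ∑ T, moranStep r w S T * f T := by
  simp only [moranDist, Finset.sum_mul, Finset.mul_sum]
  rw [Finset.sum_comm]
  simp_rw [mul_assoc]

lemma dist_sum [Nonempty V] {r : ℝ} (hr : 1 < r) (w : V → V → ℝ)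
    (hw1 : ∀ u, ∑ v, w u v = 1) (init : Finset V → ℝ) (t : ℕ) :
    ∑ T, moranDist r w init t T = ∑ T, init T := by
  induction t with
  | zero => rfl
  | succ t ih =>
    have h := dist_expect r w init t (fun _ => 1)
    simp only [mul_one, step_sum hr w hw1] at h
    rw [h, ih]

/-- lower bound for the extinction probability within a bounded number of steps -/
noncomputable def gBound (A : Finset V) (z : ℝ) (S : Finset V) : ℝ :=
  if S = ∅ then 1 else if ∃ x ∈ A, S = {x} then z else 0

lemma gBound_nonneg (A : Finset V) {z : ℝ} (hz : 0 ≤ z) (S : Finset V) :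
    0 ≤ gBound A z S := by
  unfold gBound
  split_ifs <;> linarith

lemma gBound_step [Nonempty V] {r : ℝ} (hr : 1 < r) (w : V → V → ℝ)
    (hw : ∀ u v, 0 ≤ w u v) (hw1 : ∀ u, ∑ v, w u v = 1) (A : Finset V)
    (hA : ∀ x ∈ A, ∃ y, y ≠ x ∧ w y x = 1) {z : ℝ} (hz : 0 ≤ z) (hz1 : z ≤ 1)
    (S : Finset V) :
    gBound A (1 / (r + (Fintype.card V - 1)) +
      ((Fintype.card V : ℝ) - 2) / (r + (Fintype.card V - 1)) * z) S ≤
      ∑ T, moranStep r w S T * gBound A z T := by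
  have hWS := moranW_pos hr S
  have hnn : ∀ T, 0 ≤ moranStep r w S T * gBound A z T := fun T =>
    mul_nonneg (step_nonneg hr w hw S T) (gBound_nonneg A hz T)
  by_cases hS : S = ∅
  · subst hS
    rw [step_expect]
    simp only [gBound, Finset.notMem_empty, if_false, Finset.erase_empty, if_true, mul_one]
    simp_rw [← Finset.mul_sum, hw1]
    rw [div_mul_eq_mul_div, le_div_iff₀ hWS, moranW_eq]
    simp
  by_cases hx : ∃ x ∈ A, S = {x}
  · obtain ⟨x, hxA, rfl⟩ := hx
    obtain ⟨y, hyx, hwy⟩ := hA x hxA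
    have hL : ∀ z', gBound A z' {x} = z' := by
      intro z'
      unfold gBound
      rw [if_neg hS, if_pos ⟨x, hxA, rfl⟩]
    have hW : moranW r ({x} : Finset V) = r + (Fintype.card V - 1) := by simp [moranW]
    rw [hL, step_expect, ← hW]
    set W := moranW r ({x} : Finset V)
    have key : ∀ u, (if u = x then 0 else if u = y then 1 / W else z / W) ≤
        ∑ v : V, ((if u ∈ ({x} : Finset V) then r else 1) / W) * w u v *
        gBound A z (if u ∈ ({x} : Finset V) then insert v {x} else ({x} : Finset V).erase v) := by
      intro u
      have hn : ∀ v, 0 ≤ ((if u ∈ ({x} : Finset V) then r else 1) / W) * w u v *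
        gBound A z (if u ∈ ({x} : Finset V) then insert v {x} else ({x} : Finset V).erase v) := by
        intro v
        refine mul_nonneg (mul_nonneg (div_nonneg ?_ hWS.le) (hw u v)) (gBound_nonneg A hz _)
        split_ifs <;> linarith
      by_cases hux : u = x
      · rw [if_pos hux]
        exact Finset.sum_nonneg fun v _ => hn v
      rw [if_neg hux]
      by_cases huy : u = y
      · rw [if_pos huy]
        refine le_trans ?_ (Finset.single_le_sum (fun v _ => hn v) (Finset.mem_univ x))
        subst huy
        simp [hux, hwy, gBound]
      · rw [if_neg huy]
        calc z / W = ∑ v, 1 / W * w u v * z := by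
              rw [← Finset.sum_mul, ← Finset.mul_sum, hw1]; ring
          _ ≤ _ := by
              refine Finset.sum_le_sum fun v _ => ?_
              rw [if_neg (by simpa using hux), if_neg (by simpa using hux)]
              refine mul_le_mul_of_nonneg_left ?_ (mul_nonneg (by positivity) (hw u v))
              by_cases hv : v = x
              · subst hv
                simpa [gBound] using hz1
              · rw [Finset.erase_eq_of_notMem (by simpa using hv), hL]
    refine le_trans (le_of_eq ?_) (Finset.sum_le_sum fun u _ => key u)
    have : ∀ u, (if u = x then 0 else if u = y then 1 / W else z / W) =
        z / W + (if u = x then - (z / W) else 0) + (if u = y then 1 / W - z / W else 0) := by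
      intro u
      by_cases h1 : u = x
      · have : u ≠ y := fun h => hyx (h ▸ h1)
        simp [h1, Ne.symm hyx]
      · by_cases h2 : u = y <;> simp [h1, h2, hyx]
    simp_rw [this, Finset.sum_add_distrib]
    simp
    ring
  · have : ∀ z', gBound A z' S = 0 := by
      intro z'
      unfold gBound
      rw [if_neg hS, if_neg hx]
    rw [this]
    exact Finset.sum_nonneg fun T _ => hnn T

lemma ext_bound [Nonempty V] {r : ℝ} (hr : 1 < r) (w : V → V → ℝ)
    (hw : ∀ u v, 0 ≤ w u v) (hw1 : ∀ u, ∑ v, w u v = 1) (A : Finset V)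
    (hA : ∀ x ∈ A, ∃ y, y ≠ x ∧ w y x = 1) (hn : 2 ≤ Fintype.card V) :
    (A.card : ℝ) / ((1 + r) * Fintype.card V) ≤ extinctionProb r w (uniformSingleton V) := by
  have hn' : (2:ℝ) ≤ Fintype.card V := by exact_mod_cast hn
  set n : ℝ := (Fintype.card V : ℝ) with hndef
  set q : ℝ := (n - 2) / (r + (n - 1)) with hq
  have hWp : 0 < r + (n - 1) := by linarith
  have hq0 : 0 ≤ q := div_nonneg (by linarith) hWp.le
  have hq1 : q < 1 := by rw [hq, div_lt_one hWp]; linarith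
  have hz : ∀ t : ℕ, 0 ≤ (1 - q ^ t) / (1 + r) := fun t =>
    div_nonneg (by linarith [pow_le_one₀ (n := t) hq0 hq1.le]) (by linarith)
  have hz1 : ∀ t : ℕ, (1 - q ^ t) / (1 + r) ≤ 1 := fun t => by
    rw [div_le_one (by linarith)]
    linarith [pow_nonneg hq0 t]
  have hi : ∀ S, 0 ≤ uniformSingleton V S := by
    intro S
    unfold uniformSingleton
    split_ifs <;> positivity
  have main : ∀ s t : ℕ,
      ∑ S, uniformSingleton V S * gBound A ((1 - q ^ (t + s)) / (1 + r)) S ≤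
      ∑ S, moranDist r w (uniformSingleton V) s S * gBound A ((1 - q ^ t) / (1 + r)) S := by
    intro s
    induction s with
    | zero => intro t; exact le_refl _
    | succ s ih =>
      intro t
      rw [dist_expect]
      have h1 := ih (t + 1)
      rw [show t + 1 + s = t + (s + 1) by ring] at h1
      refine h1.trans (Finset.sum_le_sum fun S _ => ?_)
      refine mul_le_mul_of_nonneg_left ?_ (dist_nonneg' hr w hw _ hi s S)
      refine le_trans (le_of_eq ?_) (gBound_step hr w hw hw1 A hA (hz t) (hz1 t) S)
      congr 1
      rw [← hndef, ← hq]
      have : 1 / (r + (n - 1)) = (1 - q) / (1 + r) := by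
        rw [hq]
        have : 1 + r ≠ 0 := by linarith
        field_simp
        ring
      rw [this, pow_succ]
      ring
  have hinit : ∀ z, ∑ S, uniformSingleton V S * gBound A z S = A.card / n * z := by
    intro z
    have h1 : ∀ S, uniformSingleton V S * gBound A z S =
        if S ∈ A.image (fun x => ({x} : Finset V)) then n⁻¹ * z else 0 := by
      intro S
      by_cases hS : ∃ x ∈ A, S = {x}
      · rw [if_pos (by obtain ⟨x, hx, rfl⟩ := hS; exact Finset.mem_image_of_mem _ hx)]
        obtain ⟨x, hx, rfl⟩ := hS
        unfold gBound uniformSingleton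
        rw [if_pos (by simp), if_neg (by simp), if_pos ⟨x, hx, rfl⟩]
      · rw [if_neg (by
          intro h
          obtain ⟨x, hx, h⟩ := Finset.mem_image.1 h
          exact hS ⟨x, hx, h.symm⟩)]
        unfold gBound uniformSingleton
        rw [if_neg hS]
        by_cases h0 : S = ∅
        · simp [h0]
        · simp [h0]
    simp_rw [h1]
    rw [Finset.sum_ite_mem, Finset.univ_inter, Finset.sum_const,
      Finset.card_image_of_injective _ Finset.singleton_injective]
    simp
    ring
  have hbdd : BddAbove (Set.range fun t : ℕ => moranDist r w (uniformSingleton V) t ∅) := by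
    refine ⟨∑ T, uniformSingleton V T, ?_⟩
    rintro _ ⟨t, rfl⟩
    rw [← dist_sum hr w hw1 _ t]
    exact Finset.single_le_sum (fun S _ => dist_nonneg' hr w hw _ hi t S) (Finset.mem_univ ∅)
  have hle : ∀ t : ℕ, (A.card : ℝ) / n * ((1 - q ^ t) / (1 + r)) ≤
      extinctionProb r w (uniformSingleton V) := by
    intro t
    refine le_trans ?_ (le_ciSup hbdd t)
    have h := main t 0
    rw [hinit] at h
    simp only [zero_add, pow_zero, sub_self, zero_div] at h
    refine h.trans (le_of_eq ?_)
    rw [Finset.sum_eq_single ∅]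
    · simp [gBound]
    · intro S _ hS
      simp [gBound, hS]
    · simp
  have hlim : Filter.Tendsto (fun t : ℕ => (A.card : ℝ) / n * ((1 - q ^ t) / (1 + r)))
      Filter.atTop (nhds ((A.card : ℝ) / n * ((1 - 0) / (1 + r)))) :=
    (((tendsto_pow_atTop_nhds_zero_of_lt_one hq0 hq1).const_sub 1).div_const _).const_mul _
  have := le_of_tendsto' hlim hle
  refine le_trans (le_of_eq ?_) this
  have : n ≠ 0 := by linarith
  have : 1 + r ≠ 0 := by linarith
  field_simp
  ring

end Helpers

/-- **Easy extinction lower bound for superstars** (Lemma 4.2).  Let `r > 1` and let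
`k`, `ℓ`, `m` be positive integers.  The discrete-time Moran process with fitness `r`
on the `(k,ℓ,m)`-superstar, started from a single initial mutant at a uniformly random
vertex, has extinction probability at least `k/(2r(m+k))`. -/
theorem superstar_extinction_simple (r : ℝ) (hr : 1 < r) (k ℓ m : ℕ)
    (hk : 0 < k) (hℓ : 0 < ℓ) (hm : 0 < m) :
    (k : ℝ) / (2 * r * ((m : ℝ) + (k : ℝ))) ≤
      extinctionProb r (outWeights (superstarOut k ℓ m))
        (uniformSingleton (SuperstarV k ℓ m)) := by
  have hcard : Fintype.card (SuperstarV k ℓ m) = ℓ * m + (ℓ * k + 1) := by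
    simp [SuperstarV]
  have hout : ∀ u, 0 < (superstarOut k ℓ m u).card := by
    have : Nonempty (Fin ℓ × Fin m) := ⟨(⟨0, hℓ⟩, ⟨0, hm⟩)⟩
    rintro (⟨i, x⟩ | ⟨i, j⟩ | _)
    · simp [superstarOut, hk]
    · simp only [superstarOut]
      split_ifs <;> simp
    · simp only [superstarOut]
      exact Finset.card_pos.2 (Finset.univ_nonempty.image _)
  have hw1 : ∀ u, ∑ v, outWeights (superstarOut k ℓ m) u v = 1 := by
    intro u
    unfold outWeights
    rw [Finset.sum_ite_mem, Finset.univ_inter, Finset.sum_const, nsmul_eq_mul]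
    exact mul_inv_cancel₀ (by exact_mod_cast (hout u).ne')
  have hw : ∀ u v, 0 ≤ outWeights (superstarOut k ℓ m) u v := by
    intro u v
    unfold outWeights
    split_ifs <;> positivity
  have hsing : ∀ u v, superstarOut k ℓ m u = {v} →
      outWeights (superstarOut k ℓ m) u v = 1 := by
    intro u v h
    simp [outWeights, h]
  let A : Finset (SuperstarV k ℓ m) :=
    (Finset.univ : Finset ((Fin ℓ × Fin k) ⊕ Unit)).image Sum.inr
  have hA : ∀ x ∈ A, ∃ y, y ≠ x ∧ outWeights (superstarOut k ℓ m) y x = 1 := by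
    rintro (x | ⟨i, ⟨j, hj⟩⟩ | _) hx
    · simp [A] at hx
    · rcases j with _ | j
      · refine ⟨Sum.inl (i, ⟨0, hm⟩), by simp, hsing _ _ ?_⟩
        simp [superstarOut, hk]
      · refine ⟨Sum.inr (Sum.inl (i, ⟨j, by omega⟩)), by simp, hsing _ _ ?_⟩
        simp [superstarOut, hj]
    · refine ⟨Sum.inr (Sum.inl (⟨0, hℓ⟩, ⟨k - 1, by omega⟩)), by simp, hsing _ _ ?_⟩
      have : ¬ (k - 1 + 1 < k) := by omega
      simp [superstarOut, this]
  have hAc : A.card = ℓ * k + 1 := by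
    simp only [A]
    rw [Finset.card_image_of_injective _ Sum.inr_injective]
    simp
  have h1 : 0 < ℓ * k := Nat.mul_pos hℓ hk
  have h := ext_bound hr _ hw hw1 A hA (by rw [hcard]; omega)
  refine le_trans ?_ h
  rw [hAc, hcard]
  have hk' : (0:ℝ) < k := by exact_mod_cast hk
  have hm' : (0:ℝ) < m := by exact_mod_cast hm
  have hl' : (0:ℝ) < ℓ := by exact_mod_cast hℓ
  have hr0 : 0 < r := by linarith
  push_cast
  rw [div_le_div_iff₀ (by positivity) (by positivity)]
  have e1 : (k:ℝ) * (ℓ * m + (ℓ * k + 1)) ≤ (ℓ * k + 1) * (m + k) := by nlinarith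
  have e2 : (0:ℝ) ≤ (ℓ * k + 1) * (m + k) := by positivity
  nlinarith [mul_le_mul_of_nonneg_right e1 (by linarith : (0:ℝ) ≤ 1 + r),
    mul_nonneg e2 (by linarith : (0:ℝ) ≤ r - 1)]
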